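/- arXiv:2103.02232 — 2 statements merged into one kernel-verified Lean document; each statement's English description precedes it below -/
import Mathlib

section
/- Let μ be a Borel measure on ℝ². Fix p ∈ ℝ², κ > 0, R ∈ (0,1], K > 0, and assume μ(B(y,s)) ≤ K s^κ for every s ∈ (0,R] and every y ∈ ℝ² with |y−p| ≤ R. Then there exists a constant C > 0, depending only on κ and K, such that for every r ∈ (0, R/2] and every x ∈ B(p,r) one has ∫_{B(x,r)} (−log|x−y|) dμ(y) ≤ C r^κ (−log r). (Note that for y ∈ B(x,r) with r ≤ 1/2 one has |x−y| < 1, so the integrand is nonnegative, and −log r > 0.) -/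
open MeasureTheory Metric

theorem summable_add_two_mul_geometric {q : ℝ} (h₀ : 0 ≤ q) (h₁ : q < 1) :
    Summable fun k : ℕ => ((k : ℝ) + 2) * q ^ k := by
  have hq : ‖q‖ < 1 := by rwa [Real.norm_of_nonneg h₀]
  have h := (summable_pow_mul_geometric_of_norm_lt_one 1 hq).add
    ((summable_geometric_of_lt_one h₀ h₁).mul_left 2)
  refine h.congr fun k => ?_
  ring

/-- A point at distance `d ≤ r ≤ 1 / 2` from the centre lies in a dyadic ball on which the
logarithm is controlled. -/
theorem exists_dyadic_neg_log_le {d r : ℝ} (hd : 0 ≤ d) (hdr : d < r) (hr : r ≤ 1 / 2) :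
    ∃ k : ℕ, d < 2 * r * (1 / 2) ^ k ∧ -Real.log d ≤ (k + 2) * -Real.log r := by
  have hr0 : 0 < r := hd.trans_lt hdr
  have hlog : Real.log r ≤ -Real.log 2 := by
    rw [← Real.log_inv]
    exact Real.log_le_log hr0 (by linarith)
  have hlog2 : 0 < Real.log 2 := Real.log_pos one_lt_two
  rcases hd.eq_or_lt with rfl | hd
  · refine ⟨0, by simpa using hr0, ?_⟩
    simp only [Real.log_zero, Nat.cast_zero]
    linarith
  obtain ⟨k, hk, hk'⟩ := exists_nat_pow_near_of_lt_one (div_pos hd hr0)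
    ((div_le_one hr0).2 hdr.le) (one_half_pos (α := ℝ)) one_half_lt_one
  rw [lt_div_iff₀ hr0] at hk
  rw [div_le_iff₀ hr0] at hk'
  have hpow : (0 : ℝ) < (1 / 2) ^ k := by positivity
  refine ⟨k, by nlinarith, ?_⟩
  have h := Real.log_le_log (by positivity) hk.le
  rw [Real.log_mul (by positivity) hr0.ne', Real.log_pow, one_div, Real.log_inv] at h
  push_cast at h
  have hk0 : (0 : ℝ) ≤ k + 1 := by positivity
  nlinarith [mul_le_mul_of_nonneg_left hlog hk0]

/-- A measure with ball growth of order `κ` integrates the logarithmic kernel over a ball. -/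
theorem lintegral_neg_log_dist_le {X : Type*} [PseudoMetricSpace X] [MeasurableSpace X]
    (μ : Measure X) {κ K r : ℝ} (hκ : 0 < κ) (hK : 0 ≤ K) (hr0 : 0 < r) (hr : r ≤ 1 / 2) (x : X)
    (hμ : ∀ s : ℝ, 0 < s → s ≤ 2 * r → μ (ball x s) ≤ ENNReal.ofReal (K * s ^ κ)) :
    ∫⁻ y in ball x r, ENNReal.ofReal (-Real.log (dist x y)) ∂μ ≤
      ENNReal.ofReal
        (K * 2 ^ κ * (∑' k : ℕ, ((k : ℝ) + 2) * ((1 / 2 : ℝ) ^ κ) ^ k) * r ^ κ * -Real.log r) := by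
  have hL : 0 ≤ -Real.log r := neg_nonneg.2 (Real.log_nonpos hr0.le (by linarith))
  have hq0 : (0 : ℝ) ≤ (1 / 2 : ℝ) ^ κ := by positivity
  have hq1 : (1 / 2 : ℝ) ^ κ < 1 := Real.rpow_lt_one (by norm_num) (by norm_num) hκ
  let c : ℕ → ℝ := fun k => (k + 2) * -Real.log r
  let A : ℕ → Set X := fun k =>
    {y | dist x y < 2 * r * (1 / 2) ^ k ∧ -Real.log (dist x y) ≤ c k}
  have hcover : ball x r ⊆ ⋃ k, A k := fun y hy =>
    Set.mem_iUnion.2 (exists_dyadic_neg_log_le dist_nonneg (mem_ball'.1 hy) hr)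
  have hterm (k : ℕ) : ∫⁻ y in A k, ENNReal.ofReal (-Real.log (dist x y)) ∂μ ≤
      ENNReal.ofReal (K * 2 ^ κ * r ^ κ * -Real.log r * ((k + 2) * ((1 / 2 : ℝ) ^ κ) ^ k)) := by
    have hs : 2 * r * (1 / 2) ^ k ≤ 2 * r :=
      mul_le_of_le_one_right (by positivity) (pow_le_one₀ (by norm_num) (by norm_num))
    have hc : 0 ≤ c k := mul_nonneg (by positivity) hL
    calc ∫⁻ y in A k, ENNReal.ofReal (-Real.log (dist x y)) ∂μ
        ≤ ∫⁻ _ in A k, ENNReal.ofReal (c k) ∂μ :=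
          setLIntegral_mono measurable_const fun y hy => ENNReal.ofReal_le_ofReal hy.2
      _ = ENNReal.ofReal (c k) * μ (A k) := setLIntegral_const _ _
      _ ≤ ENNReal.ofReal (c k) * ENNReal.ofReal (K * (2 * r * (1 / 2) ^ k) ^ κ) := by
          gcongr
          exact (measure_mono fun y hy => mem_ball'.2 hy.1).trans (hμ _ (by positivity) hs)
      _ = _ := by
          rw [← ENNReal.ofReal_mul hc, Real.mul_rpow (by positivity) (by positivity),
            Real.mul_rpow zero_le_two hr0.le, ← Real.rpow_pow_comm (by norm_num)]
          congr 1
          ring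
  calc ∫⁻ y in ball x r, ENNReal.ofReal (-Real.log (dist x y)) ∂μ
      ≤ ∫⁻ y in ⋃ k, A k, ENNReal.ofReal (-Real.log (dist x y)) ∂μ := lintegral_mono_set hcover
    _ ≤ ∑' k, ∫⁻ y in A k, ENNReal.ofReal (-Real.log (dist x y)) ∂μ := lintegral_iUnion_le _ _
    _ ≤ ∑' k : ℕ, ENNReal.ofReal
          (K * 2 ^ κ * r ^ κ * -Real.log r * ((k + 2) * ((1 / 2 : ℝ) ^ κ) ^ k)) :=
        ENNReal.tsum_le_tsum hterm
    _ = _ := by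
        rw [← ENNReal.ofReal_tsum_of_nonneg (fun k => by positivity)
          ((summable_add_two_mul_geometric hq0 hq1).mul_left _), tsum_mul_left]
        congr 1
        ring

theorem green_kernel_integral_bound_dim_two (κ K : ℝ) (hκ : 0 < κ) (hK : 0 < K) :
    ∃ C : ℝ, 0 < C ∧
      ∀ (μ : Measure (EuclideanSpace ℝ (Fin 2))) (p : EuclideanSpace ℝ (Fin 2)) (R : ℝ),
        0 < R → R ≤ 1 →
        (∀ s : ℝ, 0 < s → s ≤ R → ∀ y : EuclideanSpace ℝ (Fin 2), dist y p ≤ R →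
          μ (ball y s) ≤ ENNReal.ofReal (K * s ^ κ)) →
        ∀ r : ℝ, 0 < r → r ≤ R / 2 → ∀ x ∈ ball p r,
          ∫⁻ y in ball x r, ENNReal.ofReal (-Real.log (dist x y)) ∂μ ≤
            ENNReal.ofReal (C * r ^ κ * (-Real.log r)) := by
  have hsum : 0 < ∑' k : ℕ, ((k : ℝ) + 2) * ((1 / 2 : ℝ) ^ κ) ^ k :=
    (summable_add_two_mul_geometric (by positivity)
      (Real.rpow_lt_one (by norm_num) (by norm_num) hκ)).tsum_pos
      (fun k => by positivity) 0 (by norm_num)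
  refine ⟨_, mul_pos (by positivity : 0 < K * 2 ^ κ) hsum, ?_⟩
  intro μ p R hR hR1 hμ r hr0 hr x hx
  have hxp : dist x p < r := hx
  exact lintegral_neg_log_dist_le μ hκ hK.le hr0 (by linarith) x fun s hs hsr =>
    hμ s hs (by linarith) x (by linarith)
end

section
/- Let μ be a Borel measure on ℝ. Fix p ∈ ℝ, κ > −1, R ∈ (0,1], K > 0, and assume μ((y−s, y+s)) ≤ K s^κ for every s ∈ (0,R] and every y ∈ ℝ with |y−p| ≤ R. Then for every r ∈ (0, R/2] and every x ∈ (p−r, p+r) one has ∫_{(x−r, x+r)} [2(min(x,y)−(x−r))((x+r)−max(x,y))/(2r)] dμ(y) ≤ 4 K r^{κ+1}. -/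
open MeasureTheory

theorem green_kernel_integral_bound_dim_one (μ : Measure ℝ) (p κ R K : ℝ)
    (hκ : -1 < κ) (hR0 : 0 < R) (hR1 : R ≤ 1) (hK : 0 < K)
    (hμ : ∀ s : ℝ, 0 < s → s ≤ R → ∀ y : ℝ, |y - p| ≤ R →
      μ (Set.Ioo (y - s) (y + s)) ≤ ENNReal.ofReal (K * s ^ κ)) :
    ∀ r : ℝ, 0 < r → r ≤ R / 2 → ∀ x ∈ Set.Ioo (p - r) (p + r),
      ∫⁻ y in Set.Ioo (x - r) (x + r),
          ENNReal.ofReal (2 * (min x y - (x - r)) * ((x + r) - max x y) / (2 * r)) ∂μ ≤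
        ENNReal.ofReal (4 * K * r ^ (κ + 1)) := by
  intro r hr hrR x hx
  have hxp : |x - p| ≤ R := by
    rw [abs_le]
    constructor <;> linarith [hx.1, hx.2]
  have hkernel : ∀ y ∈ Set.Ioo (x - r) (x + r),
      2 * (min x y - (x - r)) * ((x + r) - max x y) / (2 * r) ≤ r := by
    intro y hy
    have h₁ : min x y - (x - r) ≤ r := by linarith [min_le_left x y]
    have h₂ : x + r - max x y ≤ r := by linarith [le_max_left x y]
    have h₃ : 0 ≤ x + r - max x y := sub_nonneg.2 (max_le (by linarith) hy.2.le)
    rw [div_le_iff₀ (by positivity)]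
    nlinarith [mul_le_mul h₁ h₂ h₃ hr.le]
  calc
    _ ≤ ∫⁻ _ in Set.Ioo (x - r) (x + r), ENNReal.ofReal r ∂μ :=
      setLIntegral_mono measurable_const fun y hy => ENNReal.ofReal_le_ofReal (hkernel y hy)
    _ = ENNReal.ofReal r * μ (Set.Ioo (x - r) (x + r)) := setLIntegral_const _ _
    _ ≤ ENNReal.ofReal r * ENNReal.ofReal (K * r ^ κ) := by
      gcongr
      exact hμ r hr (by linarith) x hxp
    _ = ENNReal.ofReal (K * r ^ (κ + 1)) := by
      rw [← ENNReal.ofReal_mul hr.le, Real.rpow_add_one hr.ne']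
      ring_nf
    _ ≤ ENNReal.ofReal (4 * K * r ^ (κ + 1)) := by
      apply ENNReal.ofReal_le_ofReal
      have : 0 < K * r ^ (κ + 1) := by positivity
      linarith
end
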